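/- arXiv:0907.5486 — 2 statements merged into one kernel-verified Lean document; each statement's English description precedes it below -/
import Mathlib

section
/- Let S : ℝ → ℝ be defined by S(x) = (1/(p−1))·Q(x) + (1/2)·x·Q'(x). Then ∫_ℝ Q(x)·S(x) dx = ((5−p)/(4(p−1)))·∫_ℝ Q(x)² dx; in particular this integral is strictly negative when p > 5. -/
/-- The soliton profile `Q(x) = ((p+1)/(2 cosh²(((p−1)/2)x)))^(1/(p−1))`. -/
noncomputable def Q (p : ℕ) (x : ℝ) : ℝ :=
  (((p : ℝ) + 1) / (2 * Real.cosh ((((p : ℝ) - 1) / 2) * x) ^ 2)) ^ (1 / ((p : ℝ) - 1))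

/-- The scaling direction `S(x) = (1/(p−1)) Q(x) + (1/2) x Q'(x)`. -/
noncomputable def S (p : ℕ) (x : ℝ) : ℝ :=
  (1 / ((p : ℝ) - 1)) * Q p x + (1 / 2) * x * deriv (Q p) x

open MeasureTheory

theorem Q_pos (p : ℕ) (x : ℝ) : 0 < Q p x := by
  unfold Q
  have := Real.cosh_pos ((((p : ℝ) - 1) / 2) * x)
  positivity

theorem hasDerivAt_Q {p : ℕ} (hp : 2 ≤ p) (x : ℝ) :
    HasDerivAt (Q p) (-Real.tanh ((((p : ℝ) - 1) / 2) * x) * Q p x) x := by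
  have hp' : (2 : ℝ) ≤ p := by exact_mod_cast hp
  have hp1 : (p : ℝ) - 1 ≠ 0 := by linarith
  have hc := Real.cosh_pos ((((p : ℝ) - 1) / 2) * x)
  have h1 : HasDerivAt (fun y : ℝ => (((p : ℝ) - 1) / 2) * y) (((p : ℝ) - 1) / 2) x := by
    simpa using (hasDerivAt_id x).const_mul (((p : ℝ) - 1) / 2)
  have hb : 0 < ((p : ℝ) + 1) / (2 * Real.cosh ((((p : ℝ) - 1) / 2) * x) ^ 2) := by positivity
  have h2 := (((hasDerivAt_const x ((p : ℝ) + 1)).fun_div ((h1.cosh.fun_pow 2).const_mul 2)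
    (by positivity)).rpow_const (p := 1 / ((p : ℝ) - 1)) (Or.inl hb.ne'))
  refine h2.congr_deriv ?_
  rw [Real.rpow_sub_one hb.ne', Real.tanh_eq_sinh_div_cosh]
  unfold Q
  generalize (((p : ℝ) + 1) / (2 * Real.cosh ((((p : ℝ) - 1) / 2) * x) ^ 2)) ^
    (1 / ((p : ℝ) - 1)) = q
  have hpp : (p : ℝ) + 1 ≠ 0 := by linarith
  field_simp
  ring

theorem Q_le_mul_exp_neg_abs {p : ℕ} (hp : 2 ≤ p) (x : ℝ) :
    Q p x ≤ (2 * ((p : ℝ) + 1)) ^ (1 / ((p : ℝ) - 1)) * Real.exp (-|x|) := by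
  have hp' : (2 : ℝ) ≤ p := by exact_mod_cast hp
  have hp1 : 0 < (p : ℝ) - 1 := by linarith
  have hexp : Real.exp (-|x|) = Real.exp (-((p : ℝ) - 1) * |x|) ^ (1 / ((p : ℝ) - 1)) := by
    rw [← Real.exp_mul]
    congr 1
    field_simp
  rw [hexp, ← Real.mul_rpow (by positivity) (by positivity)]
  unfold Q
  refine Real.rpow_le_rpow (by positivity) ?_ (by positivity)
  have hcosh : Real.exp ((((p : ℝ) - 1) / 2) * |x|) / 2 ≤
      Real.cosh ((((p : ℝ) - 1) / 2) * x) := by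
    rw [← Real.cosh_abs ((((p : ℝ) - 1) / 2) * x), abs_mul, abs_of_pos (half_pos hp1),
      Real.cosh_eq]
    have := Real.exp_pos (-((((p : ℝ) - 1) / 2) * |x|))
    linarith
  have hsq : Real.exp (-((p : ℝ) - 1) * |x|) =
      (Real.exp ((((p : ℝ) - 1) / 2) * |x|) ^ 2)⁻¹ := by
    rw [← Real.exp_nat_mul, ← Real.exp_neg]
    congr 1
    push_cast
    ring
  calc ((p : ℝ) + 1) / (2 * Real.cosh ((((p : ℝ) - 1) / 2) * x) ^ 2)
      ≤ ((p : ℝ) + 1) / (2 * (Real.exp ((((p : ℝ) - 1) / 2) * |x|) / 2) ^ 2) := by gcongr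
    _ = _ := by
      rw [hsq]
      field_simp

theorem integrable_exp_neg_abs : Integrable fun x : ℝ => Real.exp (-|x|) := by
  rw [← integrableOn_univ, ← Set.Iic_union_Ioi (a := (0 : ℝ)), integrableOn_union]
  constructor
  · refine (integrableOn_exp_Iic 0).congr_fun (fun x hx => ?_) measurableSet_Iic
    simp [abs_of_nonpos (Set.mem_Iic.1 hx)]
  · refine (integrableOn_exp_neg_Ioi 0).congr_fun (fun x hx => ?_) measurableSet_Ioi
    simp [abs_of_pos (Set.mem_Ioi.1 hx)]

theorem continuous_Q {p : ℕ} (hp : 2 ≤ p) : Continuous (Q p) :=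
  continuous_iff_continuousAt.2 fun x => (hasDerivAt_Q hp x).continuousAt

theorem one_add_abs_mul_Q_sq_le {p : ℕ} (hp : 2 ≤ p) (x : ℝ) :
    (1 + |x|) * Q p x ^ 2 ≤
      ((2 * ((p : ℝ) + 1)) ^ (1 / ((p : ℝ) - 1))) ^ 2 * Real.exp (-|x|) := by
  have h1 : 1 + |x| ≤ Real.exp |x| := by linarith [Real.add_one_le_exp |x|]
  have h2 := pow_le_pow_left₀ (Q_pos p x).le (Q_le_mul_exp_neg_abs hp x) 2
  calc (1 + |x|) * Q p x ^ 2 ≤ Real.exp |x| *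
        ((2 * ((p : ℝ) + 1)) ^ (1 / ((p : ℝ) - 1)) * Real.exp (-|x|)) ^ 2 := by gcongr
    _ = _ := by
      rw [Real.exp_neg]
      field_simp

theorem integrable_mul_Q_sq {p : ℕ} (hp : 2 ≤ p) {g : ℝ → ℝ} (hg : Continuous g)
    (hle : ∀ x, |g x| ≤ 1 + |x|) : Integrable fun x => g x * Q p x ^ 2 := by
  refine (integrable_exp_neg_abs.const_mul
    (((2 * ((p : ℝ) + 1)) ^ (1 / ((p : ℝ) - 1))) ^ 2)).mono'
    (hg.mul ((continuous_Q hp).pow 2)).aestronglyMeasurable (ae_of_all _ fun x => ?_)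
  rw [Real.norm_eq_abs, abs_mul, abs_of_nonneg (sq_nonneg (Q p x))]
  exact (mul_le_mul_of_nonneg_right (hle x) (sq_nonneg _)).trans (one_add_abs_mul_Q_sq_le hp x)

theorem integrable_Q_sq {p : ℕ} (hp : 2 ≤ p) : Integrable fun x => Q p x ^ 2 := by
  simpa using integrable_mul_Q_sq hp (continuous_const (y := (1 : ℝ))) fun x => by simp

theorem integral_Q_sq_pos {p : ℕ} (hp : 2 ≤ p) : 0 < ∫ x : ℝ, Q p x ^ 2 := by
  rw [integral_pos_iff_support_of_nonneg (fun x => sq_nonneg (Q p x)) (integrable_Q_sq hp)]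
  have : (Function.support fun x => Q p x ^ 2) = Set.univ :=
    Set.eq_univ_of_forall fun x => (pow_pos (Q_pos p x) 2).ne'
  simp [this]

/-- `∫ Q S = ((5−p)/(4(p−1))) ∫ Q²`; in particular `∫ Q S < 0` when `p > 5`. -/
theorem stmt9 (p : ℕ) (hp : 2 ≤ p) :
    (∫ x : ℝ, Q p x * S p x) = ((5 - (p : ℝ)) / (4 * ((p : ℝ) - 1))) * ∫ x : ℝ, Q p x ^ 2 ∧
    (5 < p → (∫ x : ℝ, Q p x * S p x) < 0) := by
  have hp' : (2 : ℝ) ≤ p := by exact_mod_cast hp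
  have hp1 : 0 < (p : ℝ) - 1 := by linarith
  let t : ℝ → ℝ := fun x => Real.tanh ((((p : ℝ) - 1) / 2) * x)
  have ht : Continuous t := by
    have : t = fun x => Real.sinh ((((p : ℝ) - 1) / 2) * x) /
        Real.cosh ((((p : ℝ) - 1) / 2) * x) := funext fun x => Real.tanh_eq_sinh_div_cosh _
    rw [this]
    exact (by fun_prop : Continuous _).div (by fun_prop) fun x => (Real.cosh_pos _).ne'
  have hxQ : Integrable fun x => x * Q p x ^ 2 :=
    integrable_mul_Q_sq hp continuous_id fun x => by simp
  have hxtQ : Integrable fun x => (x * t x) * Q p x ^ 2 := by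
    refine integrable_mul_Q_sq hp (continuous_id.mul ht) fun x => ?_
    have h1 : |t x| ≤ 1 := (Real.abs_tanh_lt_one _).le
    rw [abs_mul]
    nlinarith [abs_nonneg x]
  have hQ := integrable_Q_sq hp
  have hderiv : ∀ x, HasDerivAt (fun x => x * Q p x ^ 2)
      (Q p x ^ 2 - 2 * ((x * t x) * Q p x ^ 2)) x := fun x => by
    refine ((hasDerivAt_id x).fun_mul ((hasDerivAt_Q hp x).fun_pow 2)).congr_deriv ?_
    simp only [t, id]
    ring
  have hint : Integrable fun x => Q p x ^ 2 - 2 * ((x * t x) * Q p x ^ 2) :=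
    hQ.sub (hxtQ.const_mul 2)
  have hzero := integral_eq_zero_of_hasDerivAt_of_integrable hderiv hint hxQ
  have hmain : (∫ x : ℝ, Q p x * S p x) =
      ((5 - (p : ℝ)) / (4 * ((p : ℝ) - 1))) * ∫ x : ℝ, Q p x ^ 2 := by
    have hQS : ∀ x, Q p x * S p x = ((5 - (p : ℝ)) / (4 * ((p : ℝ) - 1))) * Q p x ^ 2 +
        (1 / 4) * (Q p x ^ 2 - 2 * ((x * t x) * Q p x ^ 2)) := fun x => by
      rw [S, (hasDerivAt_Q hp x).deriv]
      simp only [t]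
      field_simp
      ring
    simp_rw [hQS]
    rw [integral_add (hQ.const_mul _) (hint.const_mul _),
      integral_const_mul, integral_const_mul, hzero]
    simp
  refine ⟨hmain, fun h5 => ?_⟩
  have h5' : (5 : ℝ) < p := by exact_mod_cast h5
  rw [hmain]
  exact mul_neg_of_neg_of_pos (div_neg_of_neg_of_pos (by linarith) (by linarith))
    (integral_Q_sq_pos hp)
end

section
/- There exists σ₀ > 0 such that for every continuously differentiable u : ℝ → ℝ with u and u' square integrable, if ∫_ℝ u(x)·Q'(x) dx = 0 and ∫_ℝ u(x)·Q(x)^((p+1)/2) dx = 0, then ∫_ℝ u'(x)² dx + ∫_ℝ u(x)² dx − p·∫_ℝ Q(x)^(p−1)·u(x)² dx ≥ σ₀·∫_ℝ u(x)² dx. -/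
open MeasureTheory

open Real Set Filter Topology

/-- `f` is square integrable with square integrable derivative `f'`. -/
structure IsH1 (f f' : ℝ → ℝ) : Prop where
  hasDerivAt : ∀ x, HasDerivAt f (f' x) x
  memLp : MemLp f 2
  memLp_deriv : MemLp f' 2

lemma hasDerivAt_tanh_mul (a x : ℝ) :
    HasDerivAt (fun x => tanh (a * x)) (a * (1 - tanh (a * x) ^ 2)) x := by
  have hc : cosh (a * x) ≠ 0 := (cosh_pos _).ne'
  have hx : HasDerivAt (fun x : ℝ => a * x) a x := by
    simpa using (hasDerivAt_id x).const_mul a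
  have h := hx.sinh.div hx.cosh hc
  have he : (fun x => tanh (a * x)) = (fun x => sinh (a * x)) / fun x => cosh (a * x) := by
    ext y
    simp [tanh_eq_sinh_div_cosh]
  rw [he]
  refine h.congr_deriv ?_
  rw [tanh_eq_sinh_div_cosh]
  field_simp

lemma continuous_tanh_mul (a : ℝ) : Continuous fun x => tanh (a * x) :=
  continuous_iff_continuousAt.2 fun x => (hasDerivAt_tanh_mul a x).continuousAt

lemma memLp_tanh_mul {f : ℝ → ℝ} (hf : MemLp f 2) (a : ℝ) :
    MemLp (fun x => tanh (a * x) * f x) 2 := by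
  refine hf.of_le_mul (c := 1)
    ((continuous_tanh_mul a).aestronglyMeasurable.mul hf.aestronglyMeasurable) (ae_of_all _ ?_)
  intro x
  rw [norm_mul]
  gcongr
  exact (abs_tanh_lt_one _).le

lemma integrable_mul_of_memLp {f g : ℝ → ℝ} (hf : MemLp f 2) (hg : MemLp g 2) :
    Integrable fun x => f x * g x :=
  hf.integrable_mul hg

lemma integral_linear_combination_three {f g h : ℝ → ℝ} (hf : Integrable f) (hg : Integrable g)
    (hh : Integrable h) (r s t : ℝ) :
    ∫ x, (r * f x + s * g x + t * h x) = r * (∫ x, f x) + s * (∫ x, g x) + t * ∫ x, h x := by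
  rw [← integral_const_mul, ← integral_const_mul, ← integral_const_mul,
    ← integral_add (hf.const_mul r) (hg.const_mul s),
    ← integral_add (by exact (hf.const_mul r).add (hg.const_mul s)) (hh.const_mul t)]

namespace IsH1

variable {f f' g g' : ℝ → ℝ}

lemma continuous (hf : IsH1 f f') : Continuous f :=
  continuous_iff_continuousAt.2 fun x => (hf.hasDerivAt x).continuousAt

lemma tanh_mul (hf : IsH1 f f') (a : ℝ) :
    IsH1 (fun x => tanh (a * x) * f x)
      (fun x => a * (1 - tanh (a * x) ^ 2) * f x + tanh (a * x) * f' x) where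
  hasDerivAt x := (hasDerivAt_tanh_mul a x).mul (hf.hasDerivAt x)
  memLp := memLp_tanh_mul hf.memLp a
  memLp_deriv := by
    have h := ((hf.memLp.sub (memLp_tanh_mul (memLp_tanh_mul hf.memLp a) a)).const_mul a).add
      (memLp_tanh_mul hf.memLp_deriv a)
    convert h using 1
    ext x
    simp
    ring

lemma integral_mul_deriv (hf : IsH1 f f') (hg : IsH1 g g') :
    ∫ x, f x * g' x = -∫ x, f' x * g x :=
  integral_mul_deriv_eq_deriv_mul_of_integrable (fun x _ => hf.hasDerivAt x)
    (fun x _ => hg.hasDerivAt x) (hf.memLp.integrable_mul hg.memLp_deriv)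
    (hf.memLp_deriv.integrable_mul hg.memLp) (hf.memLp.integrable_mul hg.memLp)

/-- The operators `κ tanh(a x) + d/dx` and `κ tanh(a x) - d/dx` are formally adjoint. -/
lemma integral_mul_adjoint (hf : IsH1 f f') (hg : IsH1 g g') (κ a : ℝ) :
    ∫ x, f x * (κ * tanh (a * x) * g x - g' x) =
      ∫ x, g x * (κ * tanh (a * x) * f x + f' x) := by
  have h1 : Integrable fun x => κ * (f x * (tanh (a * x) * g x)) :=
    (integrable_mul_of_memLp hf.memLp (memLp_tanh_mul hg.memLp a)).const_mul κ
  have h2 := integrable_mul_of_memLp hf.memLp hg.memLp_deriv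
  have h3 := integrable_mul_of_memLp hf.memLp_deriv hg.memLp
  calc _ = ∫ x, (κ * (f x * (tanh (a * x) * g x)) - f x * g' x) := by
        congr 1; ext x; ring
    _ = ∫ x, (κ * (f x * (tanh (a * x) * g x)) + f' x * g x) := by
        rw [integral_sub h1 h2, integral_add h1 h3, hf.integral_mul_deriv hg]; ring
    _ = _ := by congr 1; ext x; ring

/-- Expansion of the square of a first-order operator, in terms of the potential
`κ² tanh² - κ a sech²`. -/
lemma integral_sq_expand (hf : IsH1 f f') (κ a : ℝ) :
    ∫ x, (κ * tanh (a * x) * f x + f' x) ^ 2 =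
      (∫ x, f' x ^ 2) +
        ((κ ^ 2 + κ * a) * (∫ x, (tanh (a * x) * f x) ^ 2) - κ * a * ∫ x, f x ^ 2) := by
  have hT := hf.tanh_mul a
  have h := hT.integral_mul_deriv hf
  have i0 := hf.memLp.integrable_sq
  have i1 := hf.memLp_deriv.integrable_sq
  have i2 := hT.memLp.integrable_sq
  have i3 := integrable_mul_of_memLp hT.memLp hf.memLp_deriv
  have e1 : ∫ x, (a * (1 - tanh (a * x) ^ 2) * f x + tanh (a * x) * f' x) * f x =
      a * (∫ x, f x ^ 2) - a * (∫ x, (tanh (a * x) * f x) ^ 2)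
        + ∫ x, tanh (a * x) * f x * f' x := by
    calc _ = ∫ x, (a * f x ^ 2 + -a * (tanh (a * x) * f x) ^ 2
          + 1 * (tanh (a * x) * f x * f' x)) := by congr 1; ext x; ring
      _ = _ := by rw [integral_linear_combination_three i0 i2 i3]; ring
  have e2 : ∫ x, (κ * tanh (a * x) * f x + f' x) ^ 2 =
      (∫ x, f' x ^ 2) + κ ^ 2 * (∫ x, (tanh (a * x) * f x) ^ 2)
        + 2 * κ * ∫ x, tanh (a * x) * f x * f' x := by
    calc _ = ∫ x, (1 * f' x ^ 2 + κ ^ 2 * (tanh (a * x) * f x) ^ 2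
          + 2 * κ * (tanh (a * x) * f x * f' x)) := by congr 1; ext x; ring
      _ = _ := by rw [integral_linear_combination_three i1 i2 i3]; ring
  rw [e2]
  rw [e1] at h
  linear_combination κ * h

/-- A lower bound for `κ tanh(a x) - d/dx` transfers to its adjoint on the range. -/
lemma le_integral_sq_of_adjoint (hf : IsH1 f f') (hg : IsH1 g g') {κ a m : ℝ} (hm : 0 < m)
    (hfg : ∀ x, f x = κ * tanh (a * x) * g x - g' x)
    (h : m * (∫ x, g x ^ 2) ≤ ∫ x, f x ^ 2) :
    m * (∫ x, f x ^ 2) ≤ ∫ x, (κ * tanh (a * x) * f x + f' x) ^ 2 := by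
  have hk : MemLp (fun x => κ * tanh (a * x) * f x + f' x) 2 := by
    have := ((memLp_tanh_mul hf.memLp a).const_mul κ).add hf.memLp_deriv
    convert this using 1
    ext x
    simp [mul_assoc]
  have e : ∫ x, f x ^ 2 = ∫ x, g x * (κ * tanh (a * x) * f x + f' x) := by
    rw [← hf.integral_mul_adjoint hg]
    congr 1; ext x; rw [← hfg, sq]
  have hpos : 0 ≤ ∫ x, (m * g x - (κ * tanh (a * x) * f x + f' x)) ^ 2 :=
    integral_nonneg fun x => sq_nonneg _
  have e2 : ∫ x, (m * g x - (κ * tanh (a * x) * f x + f' x)) ^ 2 =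
      m ^ 2 * (∫ x, g x ^ 2) - 2 * m * (∫ x, g x * (κ * tanh (a * x) * f x + f' x))
        + ∫ x, (κ * tanh (a * x) * f x + f' x) ^ 2 := by
    have i0 := hg.memLp.integrable_sq
    have i1 := integrable_mul_of_memLp hg.memLp hk
    calc _ = ∫ x, (m ^ 2 * g x ^ 2 + -(2 * m) * (g x * (κ * tanh (a * x) * f x + f' x))
          + 1 * (κ * tanh (a * x) * f x + f' x) ^ 2) := by congr 1; ext x; ring
      _ = _ := by rw [integral_linear_combination_three i0 i1 hk.integrable_sq]; ring
  rw [e2, ← e] at hpos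
  nlinarith [mul_le_mul_of_nonneg_left h hm.le]

end IsH1

/-- The solution `cosh(a x)^(-κ/a)` of `φ' = -κ tanh(a x) φ`. -/
noncomputable def sechPow (κ a x : ℝ) : ℝ := cosh (a * x) ^ (-(κ / a))

lemma sechPow_pos (κ a x : ℝ) : 0 < sechPow κ a x := rpow_pos_of_pos (cosh_pos _) _

lemma hasDerivAt_sechPow {a : ℝ} (ha : 0 < a) (κ x : ℝ) :
    HasDerivAt (sechPow κ a) (-(κ * tanh (a * x) * sechPow κ a x)) x := by
  have hc : cosh (a * x) ≠ 0 := (cosh_pos _).ne'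
  have hx : HasDerivAt (fun x : ℝ => a * x) a x := by
    simpa using (hasDerivAt_id x).const_mul a
  have h := hx.cosh.rpow_const (p := -(κ / a)) (Or.inl hc)
  refine h.congr_deriv ?_
  rw [sechPow, rpow_sub_one hc, tanh_eq_sinh_div_cosh]
  field_simp

lemma continuous_sechPow {a : ℝ} (ha : 0 < a) (κ : ℝ) : Continuous (sechPow κ a) :=
  continuous_iff_continuousAt.2 fun x => (hasDerivAt_sechPow ha κ x).continuousAt

lemma sechPow_le {a κ : ℝ} (ha : 0 < a) (hκ : 0 < κ) (x y : ℝ) :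
    sechPow κ a y ≤ 2 ^ (κ / a) * exp (-κ * (|y| - |x|)) * sechPow κ a x := by
  have hpow : 0 ≤ κ / a := by positivity
  have h1 : cosh (a * x) * exp (a * (|y| - |x|)) ≤ 2 * cosh (a * y) := by
    have hx : cosh (a * x) ≤ exp (a * |x|) := by
      rw [← cosh_abs, abs_mul, abs_of_pos ha, cosh_eq]
      have : exp (-(a * |x|)) ≤ exp (a * |x|) := by
        apply exp_le_exp.2; nlinarith [mul_nonneg ha.le (abs_nonneg x)]
      linarith
    have hy : exp (a * |y|) ≤ 2 * cosh (a * y) := by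
      rw [← cosh_abs, abs_mul, abs_of_pos ha, cosh_eq]
      have := exp_pos (-(a * |y|))
      linarith
    calc _ ≤ exp (a * |x|) * exp (a * (|y| - |x|)) := by gcongr
      _ = exp (a * |y|) := by rw [← exp_add]; ring_nf
      _ ≤ _ := hy
  have h2 := rpow_le_rpow (by positivity) h1 hpow
  rw [mul_rpow (cosh_pos _).le (exp_pos _).le, mul_rpow (by norm_num) (cosh_pos _).le,
    ← exp_mul] at h2
  have h3 : a * (|y| - |x|) * (κ / a) = κ * (|y| - |x|) := by field_simp
  rw [h3] at h2
  rw [sechPow, sechPow, rpow_neg (cosh_pos _).le, rpow_neg (cosh_pos _).le, neg_mul, exp_neg]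
  have := rpow_pos_of_pos (cosh_pos (a * x)) (κ / a)
  have := rpow_pos_of_pos (cosh_pos (a * y)) (κ / a)
  field_simp
  linarith

lemma integrable_exp_neg_mul_abs {c : ℝ} (hc : 0 < c) :
    Integrable fun x : ℝ => exp (-c * |x|) := by
  rw [← integrableOn_univ, ← Iic_union_Ioi (a := (0 : ℝ))]
  refine IntegrableOn.union ?_ ?_
  · refine (integrableOn_exp_mul_Iic hc 0).congr_fun (fun x hx => ?_) measurableSet_Iic
    simp only [abs_of_nonpos (mem_Iic.1 hx)]
    ring_nf
  · refine (exp_neg_integrableOn_Ioi 0 hc).congr_fun (fun x hx => ?_) measurableSet_Ioi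
    simp only [abs_of_pos (mem_Ioi.1 hx)]

lemma memLp_sechPow {a κ : ℝ} (ha : 0 < a) (hκ : 0 < κ) : MemLp (sechPow κ a) 2 := by
  have h : MemLp (fun x : ℝ => exp (-κ * |x|)) 2 := by
    rw [memLp_two_iff_integrable_sq (by fun_prop)]
    convert integrable_exp_neg_mul_abs (c := 2 * κ) (by positivity) using 2 with x
    rw [← exp_nat_mul]
    push_cast
    ring_nf
  refine h.of_le_mul (c := 2 ^ (κ / a)) (continuous_sechPow ha κ).aestronglyMeasurable
    (ae_of_all _ fun x => ?_)
  rw [norm_of_nonneg (sechPow_pos κ a x).le, norm_of_nonneg (exp_pos _).le]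
  simpa [sechPow] using sechPow_le ha hκ 0 x

lemma isH1_sechPow {a κ : ℝ} (ha : 0 < a) (hκ : 0 < κ) :
    IsH1 (sechPow κ a) (fun x => -(κ * tanh (a * x) * sechPow κ a x)) where
  hasDerivAt := hasDerivAt_sechPow ha κ
  memLp := memLp_sechPow ha hκ
  memLp_deriv := by
    have := ((memLp_tanh_mul (memLp_sechPow ha hκ) a).const_mul κ).neg
    convert this using 1
    ext x
    simp [mul_assoc]

lemma abs_setIntegral_mul_sechPow_le {a κ : ℝ} (ha : 0 < a) (hκ : 0 < κ) {f : ℝ → ℝ}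
    (hf : MemLp f 2) {s : Set ℝ} (hs : MeasurableSet s) {x : ℝ}
    (hx : ∀ y ∈ s, |y| - |x| = |y - x|) :
    |∫ y in s, f y * sechPow κ a y| ≤
      sechPow κ a x *
        ∫ y, (f y ^ 2 + (2 ^ (κ / a)) ^ 2 * exp (-(2 * κ) * |y|)) := by
  set C : ℝ := 2 ^ (κ / a) with hC
  have hφ := sechPow_pos κ a x
  have hE := integrable_exp_neg_mul_abs (c := 2 * κ) (by positivity)
  have hK : Integrable fun y => f y ^ 2 + C ^ 2 * exp (-(2 * κ) * |y - x|) :=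
    hf.integrable_sq.add ((hE.comp_sub_right x).const_mul _)
  have htrans : ∫ y, (f y ^ 2 + C ^ 2 * exp (-(2 * κ) * |y - x|)) =
      ∫ y, (f y ^ 2 + C ^ 2 * exp (-(2 * κ) * |y|)) := by
    rw [integral_add hf.integrable_sq ((hE.comp_sub_right x).const_mul _),
      integral_add hf.integrable_sq (hE.const_mul _), integral_const_mul, integral_const_mul,
      integral_sub_right_eq_self (fun y => exp (-(2 * κ) * |y|)) x]
  have hint : Integrable fun y => f y * sechPow κ a y :=
    integrable_mul_of_memLp hf (memLp_sechPow ha hκ)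
  rw [← htrans, ← integral_const_mul]
  calc |∫ y in s, f y * sechPow κ a y| ≤ ∫ y in s, |f y * sechPow κ a y| :=
        abs_integral_le_integral_abs
    _ ≤ ∫ y in s, sechPow κ a x * (f y ^ 2 + C ^ 2 * exp (-(2 * κ) * |y - x|)) := by
        refine setIntegral_mono_on hint.abs.integrableOn (hK.const_mul _).integrableOn hs ?_
        intro y hy
        have h := sechPow_le ha hκ x y
        rw [hx y hy] at h
        set e := exp (-κ * |y - x|) with he
        have he2 : exp (-(2 * κ) * |y - x|) = e ^ 2 := by
          rw [he, ← exp_nat_mul]; push_cast; ring_nf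
        rw [he2, abs_mul, abs_of_pos (sechPow_pos κ a y)]
        calc |f y| * sechPow κ a y ≤ |f y| * (C * e * sechPow κ a x) := by gcongr
          _ = sechPow κ a x * (|f y| * (C * e)) := by ring
          _ ≤ _ := by
            gcongr
            rw [← sq_abs (f y)]
            nlinarith [sq_nonneg (|f y| - C * e), sq_nonneg (|f y|), sq_nonneg (C * e)]
    _ ≤ _ := by
        refine setIntegral_le_integral (hK.const_mul _) (ae_of_all _ fun y => ?_)
        simp only [Pi.zero_apply]
        positivity

/-- A bounded solution of `w' = κ tanh(a x) w - f` with `f` square integrable is itself square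
integrable. -/
lemma memLp_of_bounded_solution {a κ M : ℝ} (ha : 0 < a) (hκ : 0 < κ) {f w : ℝ → ℝ}
    (hfc : Continuous f) (hf : MemLp f 2)
    (hw : ∀ x, HasDerivAt w (κ * tanh (a * x) * w x - f x) x) (hM : ∀ x, |w x| ≤ M) :
    MemLp w 2 := by
  have hwc : Continuous w := continuous_iff_continuousAt.2 fun x => (hw x).continuousAt
  have hTc := continuous_tanh_mul a
  obtain ⟨δ, hδ, hδ1, hδ2⟩ : ∃ δ : ℝ, 0 < δ ∧ δ ≤ κ ^ 2 ∧ δ ≤ κ * a :=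
    ⟨min (κ ^ 2) (κ * a), by positivity, min_le_left _ _, min_le_right _ _⟩
  rw [memLp_two_iff_integrable_sq hwc.aestronglyMeasurable]
  refine integrable_of_intervalIntegral_norm_bounded (l := atTop) (a := fun R : ℝ => -R)
    (b := fun R => R) (((∫ x, f x ^ 2) + 2 * (κ * M ^ 2)) / δ)
    (fun R => (Continuous.integrableOn_Icc (by fun_prop)).mono_set Ioc_subset_Icc_self)
    tendsto_neg_atTop_atBot tendsto_id ?_
  filter_upwards [eventually_ge_atTop (0 : ℝ)] with R hR
  have hR' : -R ≤ R := by linarith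
  have hd : ∀ x, HasDerivAt (fun x => κ * (tanh (a * x) * w x ^ 2))
      (κ * (a * (1 - tanh (a * x) ^ 2) * w x ^ 2
        + tanh (a * x) * (2 * w x * (κ * tanh (a * x) * w x - f x)))) x := fun x => by
    have := ((hasDerivAt_tanh_mul a x).mul ((hw x).pow 2)).const_mul κ
    simpa using this
  have hb : ∀ x, |κ * (tanh (a * x) * w x ^ 2)| ≤ κ * M ^ 2 := fun x => by
    rw [abs_mul, abs_mul, abs_of_pos hκ, abs_pow]
    have h1 : |w x| ^ 2 ≤ M ^ 2 := pow_le_pow_left₀ (abs_nonneg _) (hM x) 2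
    have h2 := (abs_tanh_lt_one (a * x)).le
    gcongr
    nlinarith [abs_nonneg (tanh (a * x)), sq_nonneg (|w x|)]
  have hftc := intervalIntegral.integral_eq_sub_of_hasDerivAt (a := -R) (b := R)
    (fun x _ => hd x) (Continuous.intervalIntegrable (by fun_prop) _ _)
  have hle : ∫ x in (-R)..R, f x ^ 2 ≤ ∫ x, f x ^ 2 := by
    rw [intervalIntegral.integral_of_le hR']
    exact setIntegral_le_integral hf.integrable_sq (ae_of_all _ fun x => sq_nonneg _)
  have hmono : ∫ x in (-R)..R, δ * w x ^ 2 ≤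
      ∫ x in (-R)..R, (f x ^ 2 + κ * (a * (1 - tanh (a * x) ^ 2) * w x ^ 2
        + tanh (a * x) * (2 * w x * (κ * tanh (a * x) * w x - f x)))) := by
    refine intervalIntegral.integral_mono_on hR' (Continuous.intervalIntegrable (by fun_prop) _ _)
      (Continuous.intervalIntegrable (by fun_prop) _ _) fun x _ => ?_
    have hS : 0 ≤ 1 - tanh (a * x) ^ 2 := by linarith [(tanh_sq_lt_one (a * x)).le]
    have hpot : δ ≤ κ ^ 2 * tanh (a * x) ^ 2 + κ * a * (1 - tanh (a * x) ^ 2) := by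
      nlinarith [mul_le_mul_of_nonneg_right hδ1 (sq_nonneg (tanh (a * x))),
        mul_le_mul_of_nonneg_right hδ2 hS]
    nlinarith [mul_le_mul_of_nonneg_right hpot (sq_nonneg (w x)),
      sq_nonneg (κ * tanh (a * x) * w x - f x)]
  rw [intervalIntegral.integral_add (Continuous.intervalIntegrable (by fun_prop) _ _)
    (Continuous.intervalIntegrable (by fun_prop) _ _), hftc,
    intervalIntegral.integral_const_mul] at hmono
  simp only [norm_pow, norm_eq_abs, sq_abs]
  rw [le_div_iff₀ hδ]
  have h1 := (abs_le.1 (hb R)).2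
  have h2 := (abs_le.1 (hb (-R))).1
  linarith

/-- Solvability of `κ tanh(a x) w - w' = f` when `f` is orthogonal to the kernel of the adjoint
operator. -/
lemma exists_isH1_solution {a κ : ℝ} (ha : 0 < a) (hκ : 0 < κ) {f : ℝ → ℝ}
    (hfc : Continuous f) (hf : MemLp f 2) (horth : ∫ x, f x * sechPow κ a x = 0) :
    ∃ w : ℝ → ℝ, IsH1 w (fun x => κ * tanh (a * x) * w x - f x) := by
  have hφc := continuous_sechPow ha κ
  have hint : Integrable fun y => f y * sechPow κ a y :=
    integrable_mul_of_memLp hf (memLp_sechPow ha hκ)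
  set F : ℝ → ℝ := fun x => ∫ y in Iic x, f y * sechPow κ a y with hF
  have hFeq : F = fun x => F 0 + ∫ y in (0 : ℝ)..x, f y * sechPow κ a y := by
    ext x
    rw [← intervalIntegral.integral_Iic_sub_Iic hint.integrableOn hint.integrableOn]
    simp [hF]
  have hFd : ∀ x, HasDerivAt F (f x * sechPow κ a x) x := fun x => by
    rw [hFeq]
    exact (intervalIntegral.integral_hasDerivAt_right
      (Continuous.intervalIntegrable (by fun_prop) _ _)
      (Continuous.stronglyMeasurableAtFilter (by fun_prop) _ _)
      (Continuous.continuousAt (by fun_prop))).const_add _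
  set w : ℝ → ℝ := fun x => -(F x / sechPow κ a x) with hw
  have hwd : ∀ x, HasDerivAt w (κ * tanh (a * x) * w x - f x) x := fun x => by
    have hne := (sechPow_pos κ a x).ne'
    refine ((hFd x).div (hasDerivAt_sechPow ha κ x) hne).neg.congr_deriv ?_
    simp only [hw]
    field_simp
    ring
  have hbound : ∀ x, |w x| ≤ ∫ y, (f y ^ 2 + (2 ^ (κ / a)) ^ 2 * exp (-(2 * κ) * |y|)) := by
    intro x
    have hpos := sechPow_pos κ a x
    rw [hw, abs_neg, abs_div, abs_of_pos hpos, div_le_iff₀' hpos]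
    rcases le_total x 0 with hx | hx
    · refine abs_setIntegral_mul_sechPow_le ha hκ hf measurableSet_Iic fun y hy => ?_
      rw [mem_Iic] at hy
      rw [abs_of_nonpos hx, abs_of_nonpos (hy.trans hx), abs_of_nonpos (by linarith)]
      ring
    · have hsum := intervalIntegral.integral_Iic_add_Ioi (b := x) hint.integrableOn
        hint.integrableOn
      have hFx : F x = -∫ y in Ioi x, f y * sechPow κ a y := by
        simp only [hF]
        linarith
      rw [hFx, abs_neg]
      refine abs_setIntegral_mul_sechPow_le ha hκ hf measurableSet_Ioi fun y hy => ?_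
      rw [mem_Ioi] at hy
      rw [abs_of_nonneg hx, abs_of_nonneg (by linarith), abs_of_nonneg (by linarith)]
  have hwL := memLp_of_bounded_solution ha hκ hfc hf hwd hbound
  refine ⟨w, hwd, hwL, ?_⟩
  have := ((memLp_tanh_mul hwL a).const_mul κ).sub hf
  convert this using 1
  ext x
  simp [mul_assoc]

lemma Q_eq_sechPow {p : ℕ} (hp : 2 ≤ p) (x : ℝ) :
    Q p x = (((p : ℝ) + 1) / 2) ^ (1 / ((p : ℝ) - 1)) * sechPow 1 (((p : ℝ) - 1) / 2) x := by
  have hp' : (2 : ℝ) ≤ p := by exact_mod_cast hp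
  have hp1 : (p : ℝ) - 1 ≠ 0 := by linarith
  set y := ((p : ℝ) - 1) / 2 * x with hy
  have hc := cosh_pos y
  rw [Q, sechPow, ← hy, ← div_div, div_rpow (by positivity) (by positivity), ← rpow_natCast,
    ← rpow_mul hc.le, rpow_neg hc.le, div_eq_mul_inv]
  congr 3
  push_cast
  field_simp

lemma Q_rpow_half_eq_sechPow {p : ℕ} (hp : 2 ≤ p) (x : ℝ) :
    Q p x ^ (((p : ℝ) + 1) / 2) =
      ((((p : ℝ) + 1) / 2) ^ (1 / ((p : ℝ) - 1))) ^ (((p : ℝ) + 1) / 2) *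
        sechPow (((p : ℝ) + 1) / 2) (((p : ℝ) - 1) / 2) x := by
  have hp' : (2 : ℝ) ≤ p := by exact_mod_cast hp
  have hp1 : (p : ℝ) - 1 ≠ 0 := by linarith
  rw [Q_eq_sechPow hp, mul_rpow (by positivity) (sechPow_pos _ _ _).le]
  congr 1
  rw [sechPow, sechPow, ← rpow_mul (cosh_pos _).le]
  congr 1
  field_simp

lemma Q_pow_sub_one {p : ℕ} (hp : 2 ≤ p) (x : ℝ) :
    Q p x ^ (p - 1) =
      ((p : ℝ) + 1) / 2 * (1 - tanh ((((p : ℝ) - 1) / 2) * x) ^ 2) := by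
  have hp' : (2 : ℝ) ≤ p := by exact_mod_cast hp
  have hp1 : (p : ℝ) - 1 ≠ 0 := by linarith
  set y := ((p : ℝ) - 1) / 2 * x with hy
  have hc := cosh_pos y
  have hcast : ((p - 1 : ℕ) : ℝ) = (p : ℝ) - 1 := by
    rw [Nat.cast_sub (by omega)]; simp
  rw [Q, ← hy, ← rpow_natCast, hcast, ← rpow_mul (by positivity), one_div_mul_cancel hp1, rpow_one,
    tanh_eq_sinh_div_cosh, div_pow, ← div_div, div_eq_mul_inv (_ / _)]
  congr 1
  field_simp
  linarith [cosh_sq y]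

lemma deriv_Q {p : ℕ} (hp : 2 ≤ p) (x : ℝ) :
    deriv (Q p) x = -((((p : ℝ) + 1) / 2) ^ (1 / ((p : ℝ) - 1))) *
      (tanh ((((p : ℝ) - 1) / 2) * x) * sechPow 1 (((p : ℝ) - 1) / 2) x) := by
  have hp' : (2 : ℝ) ≤ p := by exact_mod_cast hp
  have ha : 0 < ((p : ℝ) - 1) / 2 := by linarith
  rw [funext (Q_eq_sechPow hp), ((hasDerivAt_sechPow ha 1 x).const_mul _).deriv]
  ring

/-- If `(1 + a) tanh(a x) w - w'` is orthogonal to `tanh(a x) sech(a x)^(1/a)`, then `w` is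
orthogonal to `sech(a x)^(1/a)`. -/
lemma integral_mul_sechPow_eq_zero {a : ℝ} (ha : 0 < a) {u w : ℝ → ℝ}
    (hw : IsH1 w (fun x => (1 + a) * tanh (a * x) * w x - u x))
    (h : ∫ x, u x * (tanh (a * x) * sechPow 1 a x) = 0) :
    ∫ x, w x * sechPow 1 a x = 0 := by
  have hadj := ((isH1_sechPow ha one_pos).tanh_mul a).integral_mul_adjoint hw (1 + a) a
  have hl : ∫ x, tanh (a * x) * sechPow 1 a x *
      ((1 + a) * tanh (a * x) * w x - ((1 + a) * tanh (a * x) * w x - u x)) = 0 := by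
    rw [← h]
    congr 1; ext x; ring
  rw [hl] at hadj
  have hr : ∫ x, w x * ((1 + a) * tanh (a * x) * (tanh (a * x) * sechPow 1 a x) +
      (a * (1 - tanh (a * x) ^ 2) * sechPow 1 a x +
        tanh (a * x) * -(1 * tanh (a * x) * sechPow 1 a x))) =
      a * ∫ x, w x * sechPow 1 a x := by
    rw [← integral_const_mul]
    congr 1; ext x; ring
  rw [hr] at hadj
  exact (mul_eq_zero.1 hadj.symm).resolve_left ha.ne'

/-- Spectral gap for the factorised operator `(-d/dx + κ tanh(a x))(d/dx + κ tanh(a x))`,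
`κ = 1 + a`, above its first two eigenfunctions. -/
lemma le_integral_sq_of_orthogonal {a : ℝ} (ha : 1 / 2 ≤ a) {u u' : ℝ → ℝ} (hu : IsH1 u u')
    (h0 : ∫ x, u x * sechPow (1 + a) a x = 0)
    (h1 : ∫ x, u x * (tanh (a * x) * sechPow 1 a x) = 0) :
    ((1 + a) ^ 2 - 1 / 2) * (∫ x, u x ^ 2) ≤
      ∫ x, ((1 + a) * tanh (a * x) * u x + u' x) ^ 2 := by
  have ha0 : 0 < a := by linarith
  obtain ⟨w, hw⟩ := exists_isH1_solution ha0 (κ := 1 + a) (by linarith) hu.continuous hu.memLp h0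
  obtain ⟨z, hz⟩ := exists_isH1_solution ha0 one_pos hw.continuous hw.memLp
    (integral_mul_sechPow_eq_zero ha0 hw h1)
  have hz_le : 1 / 2 * (∫ x, z x ^ 2) ≤ ∫ x, w x ^ 2 := by
    have h := hz.integral_sq_expand (-1) a
    have he : ∫ x, (-1 * tanh (a * x) * z x + (1 * tanh (a * x) * z x - w x)) ^ 2 =
        ∫ x, w x ^ 2 := by congr 1; ext x; ring
    rw [he] at h
    have hd : 0 ≤ ∫ x, (1 * tanh (a * x) * z x - w x) ^ 2 :=
      integral_nonneg fun x => sq_nonneg _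
    have hT : 0 ≤ ∫ x, (tanh (a * x) * z x) ^ 2 := integral_nonneg fun x => sq_nonneg _
    have hTz : ∫ x, (tanh (a * x) * z x) ^ 2 ≤ ∫ x, z x ^ 2 := by
      refine integral_mono (memLp_tanh_mul hz.memLp a).integrable_sq hz.memLp.integrable_sq
        fun x => ?_
      simp only [mul_pow]
      exact mul_le_of_le_one_left (sq_nonneg _) (tanh_sq_lt_one _).le
    nlinarith [mul_le_mul_of_nonneg_right ha (sub_nonneg.2 hTz)]
  have hw_le := hw.le_integral_sq_of_adjoint hz (κ := 1) (a := a) (by norm_num)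
    (fun x => by ring) hz_le
  have hu_le : ((1 + a) ^ 2 - 1 / 2) * (∫ x, w x ^ 2) ≤ ∫ x, u x ^ 2 := by
    have h2 := hw.integral_sq_expand (-(1 + a)) a
    have h3 := hw.integral_sq_expand 1 a
    have he : ∫ x, (-(1 + a) * tanh (a * x) * w x + ((1 + a) * tanh (a * x) * w x - u x)) ^ 2 =
        ∫ x, u x ^ 2 := by congr 1; ext x; ring
    rw [he] at h2
    linarith
  exact hu.le_integral_sq_of_adjoint hw (by nlinarith) (fun x => by ring) hu_le

/-- Coercivity of the quadratic form `(Lu,u)` under orthogonality to `Q'` and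
`Q^((p+1)/2)`. -/
theorem stmt11 (p : ℕ) (hp : 2 ≤ p) :
    ∃ σ₀ : ℝ, 0 < σ₀ ∧ ∀ u : ℝ → ℝ, ContDiff ℝ 1 u →
      Integrable (fun x : ℝ => u x ^ 2) → Integrable (fun x : ℝ => deriv u x ^ 2) →
      (∫ x : ℝ, u x * deriv (Q p) x) = 0 →
      (∫ x : ℝ, u x * Q p x ^ (((p : ℝ) + 1) / 2)) = 0 →
      σ₀ * (∫ x : ℝ, u x ^ 2) ≤
        (∫ x : ℝ, deriv u x ^ 2) + (∫ x : ℝ, u x ^ 2)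
          - (p : ℝ) * ∫ x : ℝ, Q p x ^ (p - 1) * u x ^ 2 := by
  have hp' : (2 : ℝ) ≤ p := by exact_mod_cast hp
  set a : ℝ := ((p : ℝ) - 1) / 2 with ha
  have hκ : ((p : ℝ) + 1) / 2 = 1 + a := by rw [ha]; ring
  have hC : 0 < (((p : ℝ) + 1) / 2) ^ (1 / ((p : ℝ) - 1)) := by positivity
  refine ⟨1 / 2, by norm_num, fun u hu hu2 hu2' h1 h0 => ?_⟩
  have hud : Continuous (deriv u) := hu.continuous_deriv le_rfl
  have hH : IsH1 u (deriv u) :=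
    ⟨fun x => ((hu.differentiable one_ne_zero) x).hasDerivAt,
      (memLp_two_iff_integrable_sq hu.continuous.aestronglyMeasurable).2 hu2,
      (memLp_two_iff_integrable_sq hud.aestronglyMeasurable).2 hu2'⟩
  have h1' : ∫ x, u x * (tanh (a * x) * sechPow 1 a x) = 0 := by
    simp only [deriv_Q hp, ← ha, mul_left_comm (u _), integral_const_mul] at h1
    simpa only [mul_left_comm (u _)] using (mul_eq_zero.1 h1).resolve_left (neg_ne_zero.2 hC.ne')
  have h0' : ∫ x, u x * sechPow (1 + a) a x = 0 := by
    simp only [Q_rpow_half_eq_sechPow hp, ← ha, mul_left_comm (u _), integral_const_mul] at h0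
    rw [← hκ]
    exact (mul_eq_zero.1 h0).resolve_left (rpow_pos_of_pos hC _).ne'
  have hgap := le_integral_sq_of_orthogonal (a := a) (by rw [ha]; linarith) hH h0' h1'
  rw [hH.integral_sq_expand] at hgap
  have hpot : (p : ℝ) * ∫ x, Q p x ^ (p - 1) * u x ^ 2 =
      p * (1 + a) * ((∫ x, u x ^ 2) - ∫ x, (tanh (a * x) * u x) ^ 2) := by
    rw [← integral_sub hu2 (memLp_tanh_mul hH.memLp a).integrable_sq, mul_assoc,
      ← integral_const_mul (1 + a)]
    congr 2
    ext x
    rw [Q_pow_sub_one hp, ← ha, hκ]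
    ring
  have hpa : (p : ℝ) = 1 + 2 * a := by rw [ha]; ring
  rw [hpot, hpa]
  linarith
end
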